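/- Let s, ν ∈ ℂ with Re(s) > 0 and Re(ν) > −13/2. Then ∑_{n=1}^∞ τ(n) n^{(ν+1)/2} K_{ν+1}(s√n) = 2^{36+ν} s^{ν+1} π^{12} Γ(13+ν) ∑_{n=1}^∞ τ(n)/(s² + 16π²n)^{ν+13}, both series converging absolutely (all powers are principal branches). -/

import Mathlib

open MeasureTheory Filter Complex

/-- The modified Bessel function of the second kind `K_ν(z)` for `ν, z ∈ ℂ` with `Re z > 0`,
`K_ν(z) = ∫_0^∞ e^{-z cosh t} cosh(ν t) dt`. -/
noncomputable def besselK (ν z : ℂ) : ℂ :=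
  ∫ t in Set.Ioi (0:ℝ), Complex.exp (-z * Real.cosh t) * Complex.cosh (ν * t)

lemma sq_div_four_le_cosh (t : ℝ) : t ^ 2 / 4 ≤ Real.cosh t := by
  rw [← Real.cosh_abs, Real.cosh_eq, ← sq_abs]
  have := Real.quadratic_le_exp_of_nonneg (abs_nonneg t)
  have := Real.exp_pos (-|t|)
  nlinarith [abs_nonneg t]

lemma integrable_exp_neg_mul_cosh_mul_exp {x : ℝ} (hx : 0 < x) (m : ℝ) :
    Integrable fun t : ℝ => Real.exp (-x * Real.cosh t) * Real.exp (m * t) := by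
  have h := (integrable_cexp_quadratic (b := ((x / 4 : ℝ) : ℂ)) (by simpa using hx) m 0).norm
  refine h.mono' (by fun_prop) (.of_forall fun t => ?_)
  rw [Real.norm_of_nonneg (by positivity), ← Real.exp_add, Complex.norm_exp]
  refine Real.exp_le_exp.mpr ?_
  have : (-((x / 4 : ℝ) : ℂ) * (t:ℂ) ^ 2 + m * t + 0) = ((-(x / 4) * t ^ 2 + m * t : ℝ) : ℂ) := by
    push_cast; ring
  rw [this, ofReal_re]
  nlinarith [sq_div_four_le_cosh t]

lemma norm_exp_neg_mul_cosh_mul_exp (ν z : ℂ) (t : ℝ) :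
    ‖cexp (-z * Real.cosh t) * cexp (ν * t)‖ =
      Real.exp (-z.re * Real.cosh t) * Real.exp (ν.re * t) := by
  rw [norm_mul, Complex.norm_exp, Complex.norm_exp, re_mul_ofReal, re_mul_ofReal, neg_re]

lemma integrable_cexp_neg_mul_cosh_mul_cexp (ν : ℂ) {z : ℂ} (hz : 0 < z.re) :
    Integrable fun t : ℝ => cexp (-z * Real.cosh t) * cexp (ν * t) := by
  refine (integrable_exp_neg_mul_cosh_mul_exp hz ν.re).mono' (by fun_prop) (.of_forall fun t => ?_)
  rw [norm_exp_neg_mul_cosh_mul_exp]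

lemma besselK_eq_half_integral (ν : ℂ) {z : ℂ} (hz : 0 < z.re) :
    besselK ν z = 1 / 2 * ∫ t : ℝ, cexp (-z * Real.cosh t) * cexp (ν * t) := by
  have hi := integrable_cexp_neg_mul_cosh_mul_cexp ν hz
  have h1 : ∫ t in Set.Iic (0:ℝ), cexp (-z * Real.cosh t) * cexp (ν * t) =
      ∫ t in Set.Ioi (0:ℝ), cexp (-z * Real.cosh t) * cexp (-(ν * t)) := by
    have := integral_comp_neg_Ioi 0 fun t : ℝ => cexp (-z * Real.cosh t) * cexp (ν * t)
    simpa using this.symm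
  have hi' := (integrable_cexp_neg_mul_cosh_mul_cexp (-ν) hz).integrableOn (s := Set.Ioi 0)
  simp only [neg_mul ν] at hi'
  rw [← intervalIntegral.integral_Iic_add_Ioi hi.integrableOn hi.integrableOn (b := 0), h1,
    ← integral_add hi' hi.integrableOn, besselK, ← integral_const_mul]
  congr with t
  rw [Complex.cosh]
  ring

/-- The Bessel function `K_ν` is holomorphic in the right half-plane. -/
lemma differentiableAt_besselK (ν : ℂ) {z : ℂ} (hz : 0 < z.re) :
    DifferentiableAt ℂ (besselK ν) z := by
  have hs : {w : ℂ | z.re / 2 < w.re} ∈ nhds z :=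
    (isOpen_lt continuous_const continuous_re).mem_nhds (by simpa using hz)
  have key := hasDerivAt_integral_of_dominated_loc_of_deriv_le (μ := volume) (𝕜 := ℂ)
    (F := fun w (t : ℝ) => cexp (-w * Real.cosh t) * cexp (ν * t))
    (F' := fun w (t : ℝ) => -Real.cosh t * (cexp (-w * Real.cosh t) * cexp (ν * t)))
    (bound := fun t => 1 / 2 * (Real.exp (-(z.re / 2) * Real.cosh t) * Real.exp ((ν.re + 1) * t) +
      Real.exp (-(z.re / 2) * Real.cosh t) * Real.exp ((ν.re - 1) * t)))
    hs (.of_forall fun w => by fun_prop) (integrable_cexp_neg_mul_cosh_mul_cexp ν hz)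
    (by fun_prop) ?_ ?_ ?_
  · refine (key.2.const_mul (1 / 2)).differentiableAt.congr_of_eventuallyEq ?_
    filter_upwards [(isOpen_lt continuous_const continuous_re).mem_nhds hz] with w hw
    exact besselK_eq_half_integral ν hw
  · refine .of_forall fun t w hw => ?_
    rw [norm_mul, norm_exp_neg_mul_cosh_mul_exp, norm_neg, Complex.norm_real,
      Real.norm_of_nonneg (Real.cosh_pos t).le]
    have h1 : Real.exp (-w.re * Real.cosh t) ≤ Real.exp (-(z.re / 2) * Real.cosh t) := by
      have := Real.cosh_pos t
      have hw' : z.re / 2 < w.re := hw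
      gcongr
    calc _ ≤ Real.cosh t * (Real.exp (-(z.re / 2) * Real.cosh t) * Real.exp (ν.re * t)) := by
          have := Real.cosh_pos t
          gcongr
      _ = _ := by
        rw [add_mul, sub_mul, one_mul, Real.exp_add, Real.exp_sub, Real.cosh_eq, Real.exp_neg]
        ring
  · exact ((integrable_exp_neg_mul_cosh_mul_exp (half_pos hz) _).add
      (integrable_exp_neg_mul_cosh_mul_exp (half_pos hz) _)).const_mul _
  · refine .of_forall fun t w _ => ?_
    exact ((((hasDerivAt_neg w).mul_const (Real.cosh t : ℂ)).cexp).mul_const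
      (cexp (ν * t))).congr_deriv (by ring)

lemma exists_norm_besselK_le (ν : ℂ) {σ : ℝ} (hσ : 0 < σ) :
    ∃ C : ℝ, 0 ≤ C ∧ ∀ z : ℂ, σ ≤ z.re → ‖besselK ν z‖ ≤ C * Real.exp (-z.re) := by
  let J := ∫ t : ℝ, Real.exp (-σ * Real.cosh t) * Real.exp (ν.re * t)
  refine ⟨1 / 2 * (Real.exp σ * J), ?_, fun z hz => ?_⟩
  · have : 0 ≤ J := integral_nonneg fun t => by positivity
    positivity
  have h0 : 0 < z.re := hσ.trans_le hz
  rw [besselK_eq_half_integral ν h0, norm_mul]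
  have h1 : ‖∫ t : ℝ, cexp (-z * Real.cosh t) * cexp (ν * t)‖ ≤
      ∫ t : ℝ, Real.exp (σ - z.re) *
        (Real.exp (-σ * Real.cosh t) * Real.exp (ν.re * t)) := by
    refine norm_integral_le_of_norm_le
      ((integrable_exp_neg_mul_cosh_mul_exp hσ ν.re).const_mul _) (.of_forall fun t => ?_)
    rw [norm_exp_neg_mul_cosh_mul_exp, ← mul_assoc, ← Real.exp_add (σ - z.re)]
    refine mul_le_mul_of_nonneg_right (Real.exp_le_exp.mpr ?_) (Real.exp_pos _).le
    nlinarith [Real.one_le_cosh t]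
  rw [integral_const_mul] at h1
  have h2 : ‖(1 / 2 : ℂ)‖ = 1 / 2 := by norm_num
  rw [h2]
  calc _ ≤ 1 / 2 * (Real.exp (σ - z.re) * J) := by gcongr
    _ = _ := by rw [Real.exp_sub, Real.exp_neg]; ring

lemma integrableOn_and_integral_cpow_mul_exp_eq_besselK (ν : ℂ) {c w : ℝ} (hc : 0 < c)
    (hw : 0 < w) :
    IntegrableOn (fun x : ℝ => (x:ℂ) ^ (ν - 1) * (Real.exp (-(w / 2) * (x / c + c / x)) : ℝ))
      (Set.Ioi 0) ∧
    ∫ x in Set.Ioi (0:ℝ), (x:ℂ) ^ (ν - 1) * (Real.exp (-(w / 2) * (x / c + c / x)) : ℝ) =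
      2 * (c:ℂ) ^ ν * besselK ν w := by
  let f : ℝ → ℝ := fun t => c * Real.exp t
  have himg : f '' Set.univ = Set.Ioi 0 := by
    ext x
    simp only [f, Set.image_univ, Set.mem_range, Set.mem_Ioi]
    constructor
    · rintro ⟨t, rfl⟩; positivity
    · intro hx
      exact ⟨Real.log (x / c), by rw [Real.exp_log (by positivity)]; field_simp⟩
  have hinj : Set.InjOn f Set.univ := fun x _ y _ h => by
    simpa [f, hc.ne'] using h
  have hder : ∀ t ∈ Set.univ, HasDerivWithinAt f (f t) Set.univ t := fun t _ =>
    ((Real.hasDerivAt_exp t).const_mul c).hasDerivWithinAt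
  have hw' : 0 < (w:ℂ).re := by simpa using hw
  have hint := integrable_cexp_neg_mul_cosh_mul_cexp ν hw'
  have hcomp (t : ℝ) : |f t| • ((f t : ℂ) ^ (ν - 1) *
      (Real.exp (-(w / 2) * (f t / c + c / f t)) : ℝ)) =
      (c:ℂ) ^ ν * (cexp (-w * Real.cosh t) * cexp (ν * t)) := by
    have hf : 0 < f t := by positivity
    have h1 : -(w / 2) * (f t / c + c / f t) = -w * Real.cosh t := by
      simp only [f]
      rw [Real.cosh_eq, Real.exp_neg]
      field_simp
    have h2 : (f t : ℂ) ^ ν = (c:ℂ) ^ ν * cexp (ν * t) := by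
      simp only [f]
      push_cast
      rw [← ofReal_exp, mul_cpow_ofReal_nonneg hc.le (Real.exp_pos t).le]
      congr 1
      rw [cpow_def_of_ne_zero (by simp), ← ofReal_log (Real.exp_pos t).le, Real.log_exp, mul_comm]
    have hf' : (f t : ℂ) ≠ 0 := by exact_mod_cast hf.ne'
    rw [h1, abs_of_pos hf, real_smul, cpow_sub _ _ hf', cpow_one, h2]
    field_simp
    push_cast
    ring
  constructor
  · rw [← himg, integrableOn_image_iff_integrableOn_abs_deriv_smul .univ hder hinj]
    simp only [hcomp]
    exact (hint.const_mul _).integrableOn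
  · rw [← himg, integral_image_eq_integral_abs_deriv_smul .univ hder hinj]
    simp only [hcomp]
    rw [setIntegral_univ, integral_const_mul, besselK_eq_half_integral ν hw']
    ring

/-- The Bessel inequality for an absolutely convergent Fourier series bounded by `B`. -/
lemma norm_sq_sum_le_of_norm_fourier_series_le (a : ℕ → ℂ) (ha : Summable fun n => ‖a n‖) (B : ℝ)
    (hB : ∀ x : ℝ, ‖∑' n : ℕ, a n * cexp (2 * Real.pi * I * (n + 1) * x)‖ ≤ B) (N : ℕ) :
    ∑ n ∈ Finset.range N, ‖a n‖ ^ 2 ≤ B ^ 2 := by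
  have : Fact ((0:ℝ) < 1) := ⟨one_pos⟩
  let e : ℕ → C(AddCircle (1:ℝ), ℂ) := fun n => fourier ((n:ℤ) + 1)
  have hs : Summable fun n => a n • e n := by
    refine .of_norm ?_
    simpa [e, norm_smul, fourier_norm] using ha
  set F := ∑' n, a n • e n with hF
  have hFs : HasSum (fun n => a n • e n) F := hs.hasSum
  have hB0 : 0 ≤ B := (norm_nonneg _).trans (hB 0)
  have hFB : ‖F‖ ≤ B := by
    rw [ContinuousMap.norm_le _ hB0]
    intro x
    induction x using QuotientAddGroup.induction_on with
    | H x =>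
      have h1 : F (x : AddCircle (1:ℝ)) = ∑' n : ℕ, a n * cexp (2 * Real.pi * I * (n + 1) * x) := by
        refine (hFs.mapL (ContinuousMap.evalCLM ℂ (x : AddCircle (1:ℝ)))).tsum_eq.symm.trans ?_
        refine tsum_congr fun n => ?_
        simp only [e, ContinuousMap.evalCLM_apply, ContinuousMap.smul_apply, smul_eq_mul]
        rw [fourier_coe_apply]
        push_cast
        simp
      have := hB x
      rw [← h1] at this
      exact this
  let T := ContinuousMap.toLp (E := ℂ) 2 (AddCircle.haarAddCircle (T := (1:ℝ))) ℂ
  have hT : ‖T F‖ ≤ B := by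
    refine (T.le_opNorm F).trans ?_
    have : ‖T‖ ≤ 1 := by
      refine (ContinuousMap.toLp_norm_le _).trans ?_
      simp [measureUnivNNReal]
    nlinarith [norm_nonneg F]
  have horth := (orthonormal_fourier (T := (1:ℝ)))
  have hTs : HasSum (fun n => a n • fourierLp 2 ((n:ℤ)+1)) (T F) := by
    have := hFs.mapL T
    simpa [e, T, fourierLp] using this
  have hin (n : ℕ) : inner ℂ (fourierLp (T := (1:ℝ)) 2 ((n:ℤ)+1)) (T F) = a n := by
    have h1 := hTs.mapL (innerSL ℂ (fourierLp (T := (1:ℝ)) 2 ((n:ℤ)+1)))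
    have h2 : HasSum (fun m : ℕ => (innerSL ℂ (fourierLp (T := (1:ℝ)) 2 ((n:ℤ)+1)))
        (a m • fourierLp 2 ((m:ℤ)+1))) (a n) := by
      convert hasSum_ite_eq n (a n) using 2 with m
      simp only [innerSL_apply_apply, inner_smul_right, orthonormal_iff_ite.mp horth]
      by_cases h : m = n
      · simp [h]
      · have : ¬ ((n:ℤ)+1 = (m:ℤ)+1) := by omega
        simp [h, this]
    simpa using h1.unique h2
  have h3 := Orthonormal.sum_inner_products_le (T F) (s := Finset.range N)
    (horth.comp (fun n : ℕ => (n:ℤ)+1) (fun a b h => by simpa using h))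
  simp only [Function.comp_apply, hin] at h3
  exact h3.trans (by gcongr)

lemma integral_norm_cpow_mul_eq (ν : ℂ) (e : ℝ → ℝ) (he : ∀ x, 0 ≤ e x) :
    ∫ x in Set.Ioi (0:ℝ), ‖(x:ℂ) ^ (ν - 1) * (e x : ℝ)‖ =
      ‖∫ x in Set.Ioi (0:ℝ), (x:ℂ) ^ ((ν.re : ℂ) - 1) * (e x : ℝ)‖ := by
  have h : ∫ x in Set.Ioi (0:ℝ), (x:ℂ) ^ ((ν.re : ℂ) - 1) * (e x : ℝ) =
      ((∫ x in Set.Ioi (0:ℝ), ‖(x:ℂ) ^ (ν - 1) * (e x : ℝ)‖ : ℝ) : ℂ) := by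
    rw [← integral_complex_ofReal]
    refine setIntegral_congr_fun measurableSet_Ioi fun x hx => ?_
    have hx' : (0:ℝ) < x := hx
    rw [norm_mul, norm_cpow_eq_rpow_re_of_pos hx', Complex.norm_real, Real.norm_of_nonneg (he x),
      ofReal_mul, ofReal_cpow hx'.le]
    simp
  rw [h, Complex.norm_real, Real.norm_of_nonneg (integral_nonneg fun x => norm_nonneg _)]

section

open UpperHalfPlane hiding I

/-- The `q`-expansion of the modular discriminant has coefficients `τ n`. -/
lemma hasSum_tau_discriminant {τ : ℕ → ℤ} (hτ : ∀ q : ℂ, ‖q‖ < 1 →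
      ∑' n : ℕ, (τ (n+1) : ℂ) * q ^ (n+1) = q * ∏' m : ℕ, (1 - q ^ (m+1)) ^ 24)
    (z : ℍ) :
    HasSum (fun n : ℕ => (τ (n+1) : ℂ) * cexp (2 * Real.pi * I * z) ^ (n+1))
      (ModularForm.discriminant z) := by
  have h1 := hτ (cexp (2 * Real.pi * I * z)) (by simpa using norm_exp_two_pi_I_lt_one z)
  have h2 : ModularForm.discriminant z =
      ∑' n : ℕ, (τ (n+1) : ℂ) * cexp (2 * Real.pi * I * z) ^ (n+1) := by
    rw [h1, ModularForm.discriminant_eq_q_prod]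
    simp [ModularForm.eta_q_eq_pow, Function.Periodic.qParam]
  have h3 : Summable (fun n : ℕ => (τ (n+1) : ℂ) * cexp (2 * Real.pi * I * z) ^ (n+1)) := by
    by_contra h
    exact ModularForm.discriminant_ne_zero z (h2.trans (tsum_eq_zero_of_not_summable h))
  rw [h2]
  exact h3.hasSum

/-- The mean-square bound `∑_{n ≤ N} τ(n)² = O(N¹²)`. -/
lemma exists_sum_sq_tau_le {τ : ℕ → ℤ} (hτ : ∀ q : ℂ, ‖q‖ < 1 →
      ∑' n : ℕ, (τ (n+1) : ℂ) * q ^ (n+1) = q * ∏' m : ℕ, (1 - q ^ (m+1)) ^ 24) : ∃ C : ℝ, 0 ≤ C ∧ ∀ N : ℕ, 0 < N →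
    ∑ n ∈ Finset.range N, |(τ (n+1) : ℝ)| ^ 2 ≤ C * (N:ℝ) ^ 12 := by
  obtain ⟨C, hC⟩ := CuspFormClass.exists_bound CuspForm.discriminant
  refine ⟨(C * Real.exp (2 * Real.pi)) ^ 2, by positivity, fun N hN => ?_⟩
  have hN' : (0:ℝ) < N := by exact_mod_cast hN
  let y : ℝ := 1 / N
  have hy : 0 < y := by positivity
  let z (x : ℝ) : ℍ := ⟨x + y * I, by simpa using hy⟩
  have hz (x : ℝ) (n : ℕ) : cexp (2 * Real.pi * I * z x) ^ (n+1) =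
      Real.exp (-2 * Real.pi * y * (n + 1)) * cexp (2 * Real.pi * I * (n + 1) * x) := by
    rw [← Complex.exp_nat_mul, ofReal_exp, ← Complex.exp_add]
    congr 1
    simp only [z]
    push_cast
    ring_nf
    simp only [I_sq]
    ring
  have hsum (x : ℝ) := hasSum_tau_discriminant hτ (z x)
  simp only [hz, ← mul_assoc] at hsum
  have key := norm_sq_sum_le_of_norm_fourier_series_le
    (fun n => (τ (n+1) : ℂ) * (Real.exp (-2 * Real.pi * y * (n + 1)) : ℝ)) ?_ (C * (N:ℝ)^6) ?_ N
  · calc _ ≤ ∑ n ∈ Finset.range N, Real.exp (2 * Real.pi) ^ 2 *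
          ‖(τ (n+1) : ℂ) * (Real.exp (-2 * Real.pi * y * (n + 1)) : ℝ)‖ ^ 2 := by
          refine Finset.sum_le_sum fun n hn => ?_
          rw [← mul_pow]
          gcongr
          rw [norm_mul, Complex.norm_real, Complex.norm_intCast,
            Real.norm_of_nonneg (by positivity), mul_left_comm, ← Real.exp_add]
          refine le_mul_of_one_le_right (abs_nonneg _) (Real.one_le_exp ?_)
          have : (n:ℝ) + 1 ≤ N := by exact_mod_cast Finset.mem_range.mp hn
          have h2 : y * (n + 1) ≤ 1 := by
            simp only [y]
            rw [div_mul_eq_mul_div, one_mul, div_le_one hN']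
            exact this
          nlinarith [Real.pi_pos]
      _ ≤ Real.exp (2 * Real.pi) ^ 2 * (C * (N:ℝ)^6) ^ 2 := by
          rw [← Finset.mul_sum]
          gcongr
      _ = _ := by ring
  · have := (hsum 0).summable.norm
    simpa using this
  · intro x
    rw [(hsum x).tsum_eq]
    refine (hC (z x)).trans (le_of_eq ?_)
    have : (z x).im = y := by simp [z, UpperHalfPlane.im]
    rw [this]
    have h6 : (((12:ℤ):ℝ) / 2) = ((6:ℕ):ℝ) := by norm_num
    rw [h6, Real.rpow_natCast]
    simp [y]

lemma summable_abs_tau_mul_rpow {τ : ℕ → ℤ} (hτ : ∀ q : ℂ, ‖q‖ < 1 →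
      ∑' n : ℕ, (τ (n+1) : ℂ) * q ^ (n+1) = q * ∏' m : ℕ, (1 - q ^ (m+1)) ^ 24)
    {p : ℝ} (hp : 13 / 2 < p) :
    Summable fun n : ℕ => |(τ (n+1) : ℝ)| * ((n:ℝ) + 1) ^ (-p) := by
  obtain ⟨C, hC0, hC⟩ := exists_sum_sq_tau_le hτ
  have h1 : LSeriesSummable (fun n => (τ n : ℂ)) p := by
    refine LSeriesSummable_of_sum_norm_bigO (r := 13 / 2) ?_ (by norm_num) (by simpa using hp)
    refine Asymptotics.IsBigO.of_bound (√C) ?_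
    filter_upwards [eventually_gt_atTop 0] with N hN
    rw [Real.norm_of_nonneg (by positivity), Real.norm_of_nonneg (by positivity)]
    have h2 : ∑ k ∈ Finset.Icc 1 N, ‖(τ k : ℂ)‖ = ∑ n ∈ Finset.range N, |(τ (n+1) : ℝ)| := by
      rw [Finset.range_eq_Ico, Finset.sum_Ico_add' (fun k => |(τ k : ℝ)|)]
      simp only [Complex.norm_intCast]
      rfl
    rw [h2]
    have h3 : (∑ n ∈ Finset.range N, |(τ (n+1) : ℝ)|) ^ 2 ≤ C * (N:ℝ) ^ 13 := by
      refine (sq_sum_le_card_mul_sum_sq).trans ?_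
      rw [Finset.card_range]
      calc _ ≤ (N:ℝ) * (C * (N:ℝ)^12) := by gcongr; exact hC N hN
        _ = _ := by ring
    refine le_of_sq_le_sq ?_ (by positivity)
    rw [mul_pow, Real.sq_sqrt hC0, ← Real.rpow_mul_natCast (by positivity)]
    norm_num
    exact_mod_cast h3
  have h4 := ((summable_nat_add_iff 1).mpr h1).norm
  refine h4.congr fun n => ?_
  rw [LSeries.term_of_ne_zero (by simp), norm_div, Complex.norm_natCast_cpow_of_pos (by simp),
    Complex.norm_intCast, Real.rpow_neg (by positivity)]
  simp [div_eq_mul_inv]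

lemma hasSum_tau_mul_exp_neg {τ : ℕ → ℤ} (hτ : ∀ q : ℂ, ‖q‖ < 1 →
      ∑' n : ℕ, (τ (n+1) : ℂ) * q ^ (n+1) = q * ∏' m : ℕ, (1 - q ^ (m+1)) ^ 24)
    {y : ℝ} (hy : 0 < y) :
    HasSum (fun n : ℕ => (τ (n+1) : ℂ) * (Real.exp (-(2 * Real.pi * (n + 1) * y)) : ℝ))
      (ModularForm.discriminant ⟨y * I, by simpa using hy⟩) := by
  convert hasSum_tau_discriminant hτ ⟨y * I, by simpa using hy⟩ using 3 with n
  rw [← Complex.exp_nat_mul, ofReal_exp]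
  congr 1
  push_cast
  ring_nf
  simp only [I_sq]
  ring

/-- The modular transformation of the discriminant on the imaginary axis. -/
lemma tsum_tau_mul_exp_neg_div {τ : ℕ → ℤ} (hτ : ∀ q : ℂ, ‖q‖ < 1 →
      ∑' n : ℕ, (τ (n+1) : ℂ) * q ^ (n+1) = q * ∏' m : ℕ, (1 - q ^ (m+1)) ^ 24)
    {x : ℝ} (hx : 0 < x) :
    ∑' n : ℕ, (τ (n+1) : ℂ) * (Real.exp (-(2 * Real.pi * (n + 1) * x⁻¹)) : ℝ) =
      x ^ 12 * ∑' n : ℕ, (τ (n+1) : ℂ) * (Real.exp (-(2 * Real.pi * (n + 1) * x)) : ℝ) := by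
  rw [(hasSum_tau_mul_exp_neg hτ hx).tsum_eq,
    (hasSum_tau_mul_exp_neg hτ (inv_pos.mpr hx)).tsum_eq]
  have h := congrFun ModularForm.discriminant_S_invariant ⟨x * I, by simpa using hx⟩
  rw [ModularForm.SL_slash_apply, modular_S_smul, ModularGroup.denom_S] at h
  have hx0 : (x:ℂ) ≠ 0 := by exact_mod_cast hx.ne'
  have h1 : (-(x * I : ℂ))⁻¹ = (x⁻¹ : ℝ) * I := by
    push_cast
    rw [← mul_neg, mul_inv, inv_neg, inv_I, neg_neg]
  have h2 : (x * I : ℂ) ^ 12 = x ^ 12 := by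
    rw [mul_pow, show (12:ℕ) = 4 * 3 by norm_num, pow_mul I, I_pow_four, one_pow, mul_one]
  simp only [ModularForm.discriminant] at h ⊢
  simp only [h1, h2, zpow_neg, zpow_ofNat] at h
  rw [← h]
  field_simp

lemma summable_abs_tau_mul_exp_neg_sqrt {τ : ℕ → ℤ} (hτ : ∀ q : ℂ, ‖q‖ < 1 →
      ∑' n : ℕ, (τ (n+1) : ℂ) * q ^ (n+1) = q * ∏' m : ℕ, (1 - q ^ (m+1)) ^ 24)
    {σ : ℝ} (hσ : 0 < σ) (k : ℝ) :
    Summable fun n : ℕ => |(τ (n+1) : ℝ)| * ((n:ℝ) + 1) ^ k * Real.exp (-σ * √((n:ℝ) + 1)) := by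
  refine summable_of_isBigO_nat (summable_abs_tau_mul_rpow hτ (p := 7) (by norm_num)) ?_
  have ht : Tendsto (fun n : ℕ => √((n:ℝ) + 1)) atTop atTop :=
    Real.tendsto_sqrt_atTop.comp (tendsto_atTop_add_const_right _ _ tendsto_natCast_atTop_atTop)
  have h1 := ((isLittleO_exp_neg_mul_rpow_atTop hσ (-2 * (k + 7))).isBigO).comp_tendsto ht
  have h2 := (Asymptotics.isBigO_refl (fun n : ℕ => |(τ (n+1) : ℝ)| * ((n:ℝ) + 1) ^ k) atTop).mul h1
  refine h2.congr_right fun n => ?_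
  simp only [Function.comp_apply]
  have hn : (0:ℝ) < n + 1 := by positivity
  rw [Real.sqrt_eq_rpow, ← Real.rpow_mul hn.le, mul_assoc, ← Real.rpow_add hn]
  ring_nf

/-- The identity for real positive `s`, obtained by integrating the modular relation termwise. -/
lemma tsum_tau_mul_besselK_eq_of_pos {τ : ℕ → ℤ} (hτ : ∀ q : ℂ, ‖q‖ < 1 →
      ∑' n : ℕ, (τ (n+1) : ℂ) * q ^ (n+1) = q * ∏' m : ℕ, (1 - q ^ (m+1)) ^ 24)
    {ν : ℂ} (hν : -13/2 < ν.re) {s : ℝ} (hs : 0 < s) :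
    ∑' n : ℕ, (τ (n+1) : ℂ) * ((n+1 : ℕ) : ℂ) ^ ((ν+1)/2) * besselK (ν+1) (s * Real.sqrt (n+1))
      = (2:ℂ) ^ (36 + ν) * s ^ (ν+1) * (Real.pi : ℂ)^12 * Complex.Gamma (13 + ν)
        * ∑' n : ℕ,
            (τ (n+1) : ℂ) / (s^2 + 16 * (Real.pi : ℂ)^2 * (n+1 : ℕ)) ^ (ν + 13) := by
  have hpi := Real.pi_pos
  let c (n : ℕ) : ℝ := 4 * Real.pi * √((n:ℝ) + 1) / s
  let w (n : ℕ) : ℝ := s * √((n:ℝ) + 1)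
  let r (n : ℕ) : ℝ := s ^ 2 / (8 * Real.pi) + 2 * Real.pi * (n + 1)
  have hsq (n : ℕ) : 0 < √((n:ℝ) + 1) := by positivity
  have hc (n : ℕ) : 0 < c n := by positivity
  have hw (n : ℕ) : 0 < w n := by positivity
  have hr (n : ℕ) : 0 < r n := by positivity
  let f (n : ℕ) (x : ℝ) : ℂ := (τ (n+1) : ℂ) *
    ((x:ℂ) ^ ((ν + 1) - 1) * (Real.exp (-(w n / 2) * (x / c n + c n / x)) : ℝ))
  let g (n : ℕ) (x : ℝ) : ℂ := (τ (n+1) : ℂ) *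
    ((x:ℂ) ^ ((ν + 13) - 1) * (Real.exp (-(r n * x)) : ℝ))
  have hf1 (n : ℕ) := integrableOn_and_integral_cpow_mul_exp_eq_besselK (ν + 1) (hc n) (hw n)
  have hf2 (n : ℕ) := integrableOn_and_integral_cpow_mul_exp_eq_besselK ((ν + 1).re) (hc n) (hw n)
  have hp : 0 < (ν + 13).re := by simp; linarith
  have hg1 (n : ℕ) : ∫ x in Set.Ioi (0:ℝ), (x:ℂ) ^ ((ν + 13) - 1) * (Real.exp (-(r n * x)) : ℝ) =
      (1 / (r n : ℂ)) ^ (ν + 13) * Gamma (ν + 13) := by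
    rw [← integral_cpow_mul_exp_neg_mul_Ioi hp (hr n)]
    simp
  have hg2 (n : ℕ) : ∫ x in Set.Ioi (0:ℝ), (x:ℂ) ^ (((ν + 13).re : ℂ) - 1) *
      (Real.exp (-(r n * x)) : ℝ) = (1 / (r n : ℂ)) ^ ((ν + 13).re : ℂ) * Gamma (ν + 13).re := by
    rw [← integral_cpow_mul_exp_neg_mul_Ioi (by simpa using hp) (hr n)]
    simp
  have hgi (n : ℕ) : IntegrableOn (fun x : ℝ => (x:ℂ) ^ ((ν + 13) - 1) *
      (Real.exp (-(r n * x)) : ℝ)) (Set.Ioi 0) := by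
    refine not_imp_comm.mp integral_undef ?_
    rw [hg1]
    have : (1 / (r n : ℂ)) ≠ 0 := one_div_ne_zero (by exact_mod_cast (hr n).ne')
    exact mul_ne_zero (by simp [cpow_eq_zero_iff, (hr n).ne']) (Gamma_ne_zero_of_re_pos hp)
  have hfsum : HasSum (fun n => ∫ x in Set.Ioi (0:ℝ), f n x)
      (∫ x in Set.Ioi (0:ℝ), ∑' n, f n x) := by
    refine hasSum_integral_of_summable_integral_norm (fun n => (hf1 n).1.const_mul _) ?_
    obtain ⟨C, hC0, hC⟩ := exists_norm_besselK_le ((ν + 1).re) hs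
    refine .of_nonneg_of_le (fun n => integral_nonneg fun x => norm_nonneg _) (fun n => ?_)
      ((summable_abs_tau_mul_exp_neg_sqrt hτ hs ((ν + 1).re / 2)).mul_left
        (2 * (4 * Real.pi / s) ^ (ν + 1).re * C))
    simp only [f, norm_mul (τ _ : ℂ)]
    rw [integral_const_mul, integral_norm_cpow_mul_eq _ _ (fun x => (Real.exp_pos _).le),
      (hf2 n).2, norm_mul, norm_mul, Complex.norm_intCast, norm_cpow_eq_rpow_re_of_pos (hc n),
      ofReal_re]
    have h1 : c n ^ (ν + 1).re =
        (4 * Real.pi / s) ^ (ν + 1).re * ((n:ℝ) + 1) ^ ((ν + 1).re / 2) := by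
      simp only [c]
      rw [mul_div_right_comm, Real.mul_rpow (by positivity) (by positivity), Real.sqrt_eq_rpow,
        ← Real.rpow_mul (by positivity)]
      ring_nf
    have h2 := hC (w n) (by
      simp only [w, ofReal_re]
      exact le_mul_of_one_le_right hs.le (Real.one_le_sqrt.mpr (by simp)))
    rw [ofReal_re] at h2
    rw [h1]
    calc _ ≤ |(τ (n+1) : ℝ)| * (‖(2:ℂ)‖ * ((4 * Real.pi / s) ^ (ν + 1).re *
            ((n:ℝ) + 1) ^ ((ν + 1).re / 2)) * (C * Real.exp (-w n))) := by gcongr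
      _ = _ := by simp only [w, Complex.norm_ofNat, neg_mul]; ring
  have hgsum : HasSum (fun n => ∫ x in Set.Ioi (0:ℝ), g n x)
      (∫ x in Set.Ioi (0:ℝ), ∑' n, g n x) := by
    refine hasSum_integral_of_summable_integral_norm (fun n => (hgi n).const_mul _) ?_
    refine .of_nonneg_of_le (fun n => integral_nonneg fun x => norm_nonneg _) (fun n => ?_)
      ((summable_abs_tau_mul_rpow hτ (p := (ν + 13).re) (by simp; linarith)).mul_left
        ‖Gamma (ν + 13).re‖)
    simp only [g, norm_mul (τ _ : ℂ)]
    rw [integral_const_mul, integral_norm_cpow_mul_eq _ _ (fun x => (Real.exp_pos _).le),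
      hg2, norm_mul, Complex.norm_intCast, ← ofReal_one, ← ofReal_div,
      norm_cpow_eq_rpow_re_of_pos (one_div_pos.mpr (hr n)), ofReal_re, one_div,
      Real.inv_rpow (hr n).le, ← Real.rpow_neg (hr n).le]
    have h1 : r n ^ (-(ν + 13).re) ≤ ((n:ℝ) + 1) ^ (-(ν + 13).re) := by
      refine Real.rpow_le_rpow_of_nonpos (by positivity) ?_ (by linarith)
      have : 0 ≤ s ^ 2 / (8 * Real.pi) := by positivity
      have h3 := Real.pi_gt_three
      simp only [r]
      nlinarith [(Nat.cast_nonneg n : (0:ℝ) ≤ n)]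
    calc _ ≤ |(τ (n+1) : ℝ)| * (((n:ℝ) + 1) ^ (-(ν + 13).re) * ‖Gamma (ν + 13).re‖) := by gcongr
      _ = _ := by ring
  have hfg : ∫ x in Set.Ioi (0:ℝ), ∑' n, f n x = ∫ x in Set.Ioi (0:ℝ), ∑' n, g n x := by
    refine setIntegral_congr_fun measurableSet_Ioi fun x hx => ?_
    have hx0 : (0:ℝ) < x := hx
    have hxc : (x:ℂ) ≠ 0 := by exact_mod_cast hx0.ne'
    have e1 (n : ℕ) : f n x = (x:ℂ) ^ ν * (Real.exp (-(s ^ 2 / (8 * Real.pi) * x)) : ℝ) *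
        ((τ (n+1) : ℂ) * (Real.exp (-(2 * Real.pi * (n + 1) * x⁻¹)) : ℝ)) := by
      have : -(w n / 2) * (x / c n + c n / x) =
          -(s ^ 2 / (8 * Real.pi) * x) + -(2 * Real.pi * (n + 1) * x⁻¹) := by
        simp only [w, c]
        have := hsq n
        have h2 : √((n:ℝ) + 1) ^ 2 = n + 1 := Real.sq_sqrt (by positivity)
        generalize √((n:ℝ) + 1) = q at this h2 ⊢
        rw [← h2]
        field_simp
        ring
      simp only [f]
      rw [this, Real.exp_add, add_sub_cancel_right]
      push_cast
      ring
    have e2 (n : ℕ) : g n x = (x:ℂ) ^ ν * (Real.exp (-(s ^ 2 / (8 * Real.pi) * x)) : ℝ) *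
        (x ^ 12 * ((τ (n+1) : ℂ) * (Real.exp (-(2 * Real.pi * (n + 1) * x)) : ℝ))) := by
      have : -(r n * x) = -(s ^ 2 / (8 * Real.pi) * x) + -(2 * Real.pi * (n + 1) * x) := by
        simp only [r]
        ring
      simp only [g]
      have h3 : (x:ℂ) ^ (ν + 13 - 1) = x ^ ν * x ^ 12 := by
        rw [show ν + 13 - 1 = ν + ((12:ℕ):ℂ) by push_cast; ring, cpow_add _ _ hxc, cpow_natCast]
      rw [this, Real.exp_add, h3]
      push_cast
      ring
    simp only [e1, e2]
    rw [tsum_mul_left, tsum_mul_left, tsum_mul_left, tsum_tau_mul_exp_neg_div hτ hx0]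
  have hmain := hfsum.tsum_eq.trans (hfg.trans hgsum.tsum_eq.symm)
  have hs0 : (s:ℂ) ≠ 0 := by exact_mod_cast hs.ne'
  have hpow {x : ℝ} (hx : 0 < x) (p : ℂ) : (x:ℂ) ^ p = cexp (Real.log x * p) := by
    rw [cpow_def_of_ne_zero (by exact_mod_cast hx.ne'), ofReal_log hx.le]
  have hfn (n : ℕ) : ∫ x in Set.Ioi (0:ℝ), f n x = 2 * ((4 * Real.pi / s : ℝ) : ℂ) ^ (ν + 1) *
      ((τ (n+1) : ℂ) * ((n+1 : ℕ) : ℂ) ^ ((ν+1)/2) * besselK (ν+1) (s * Real.sqrt (n+1))) := by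
    have h1 : (c n : ℂ) ^ (ν + 1) =
        ((4 * Real.pi / s : ℝ) : ℂ) ^ (ν + 1) * ((n+1 : ℕ) : ℂ) ^ ((ν+1)/2) := by
      have : ((n+1 : ℕ) : ℂ) = (((n:ℝ) + 1 : ℝ) : ℂ) := by push_cast; rfl
      rw [this, hpow (hc n), hpow (by positivity), hpow (by positivity), ← Complex.exp_add]
      congr 1
      simp only [c]
      rw [mul_div_right_comm, Real.log_mul (by positivity) (hsq n).ne',
        Real.log_sqrt (by positivity)]
      push_cast
      ring
    simp only [f]
    rw [integral_const_mul, (hf1 n).2, h1]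
    simp only [w, ofReal_mul]
    ring
  have hgn (n : ℕ) : ∫ x in Set.Ioi (0:ℝ), g n x =
      ((8 * Real.pi : ℝ) : ℂ) ^ (ν + 13) * Gamma (13 + ν) *
      ((τ (n+1) : ℂ) / (s^2 + 16 * (Real.pi : ℂ)^2 * (n+1 : ℕ)) ^ (ν + 13)) := by
    have h1 : (1 / (r n : ℂ)) ^ (ν + 13) = ((8 * Real.pi : ℝ) : ℂ) ^ (ν + 13) /
        (s^2 + 16 * (Real.pi : ℂ)^2 * (n+1 : ℕ)) ^ (ν + 13) := by
      have : (s^2 + 16 * (Real.pi : ℂ)^2 * (n+1 : ℕ)) =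
          ((s^2 + 16 * Real.pi^2 * (n+1) : ℝ) : ℂ) := by push_cast; rfl
      have h2 : (1 / (r n : ℂ)) = ((1 / r n : ℝ) : ℂ) := by push_cast; rfl
      rw [this, h2, hpow (one_div_pos.mpr (hr n)), hpow (by positivity), hpow (by positivity),
        ← Complex.exp_sub]
      congr 1
      have h3 : 1 / r n = 8 * Real.pi / (s^2 + 16 * Real.pi^2 * (n+1)) := by
        simp only [r]
        field_simp
        ring
      rw [h3, Real.log_div (by positivity) (by positivity)]
      push_cast
      ring
    simp only [g]
    rw [integral_const_mul, hg1, h1, add_comm (13:ℂ)]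
    ring
  simp only [hfn, hgn] at hmain
  rw [tsum_mul_left, tsum_mul_left] at hmain
  have hconst : 2 * ((4 * Real.pi / s : ℝ) : ℂ) ^ (ν + 1) *
      ((2:ℂ) ^ (36 + ν) * s ^ (ν+1) * (Real.pi : ℂ)^12) = ((8 * Real.pi : ℝ) : ℂ) ^ (ν + 13) := by
    have h2 : (2:ℂ) = cexp (Real.log 2) := by
      rw [← ofReal_exp, Real.exp_log two_pos, ofReal_ofNat]
    have h3 : (2:ℂ) ^ (36 + ν) = cexp (Real.log 2 * (36 + ν)) := by
      rw [← hpow two_pos, ofReal_ofNat]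
    have h4 : (Real.pi:ℂ) ^ 12 = cexp (Real.log Real.pi * 12) := by
      rw [← hpow Real.pi_pos, ← cpow_natCast, Nat.cast_ofNat]
    rw [h3, h4, hpow hs, hpow (by positivity), hpow (by positivity)]
    nth_rw 1 [h2]
    simp only [← Complex.exp_add]
    congr 1
    have h8 : Real.log 8 = 3 * Real.log 2 := by
      rw [show (8:ℝ) = 2 ^ 3 by norm_num, Real.log_pow]; norm_num
    have h44 : Real.log 4 = 2 * Real.log 2 := by
      rw [show (4:ℝ) = 2 ^ 2 by norm_num, Real.log_pow]; norm_num
    rw [Real.log_div (by positivity) hs.ne', Real.log_mul (by norm_num) hpi.ne',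
      Real.log_mul (by norm_num) hpi.ne', h8, h44]
    push_cast
    ring
  have hne : 2 * ((4 * Real.pi / s : ℝ) : ℂ) ^ (ν + 1) ≠ 0 := by
    rw [hpow (by positivity)]
    simp
  refine mul_left_cancel₀ hne ?_
  rw [hmain, ← hconst]
  ring
end

lemma norm_sq_add_sq_mul_ge {σ R : ℝ} (hσ : 0 < σ) {z : ℂ} (h1 : σ < z.re) (h2 : ‖z‖ < R)
    {x : ℝ} (hx : 1 ≤ x) : min 1 (σ / R ^ 2) * x ≤ ‖z ^ 2 + 16 * (Real.pi : ℂ) ^ 2 * x‖ := by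
  have hpi := Real.pi_gt_three
  have hR : 0 < R := (norm_nonneg z).trans_lt h2
  rcases le_or_gt (R ^ 2) x with h | h
  · have h3 : ‖z‖ ^ 2 ≤ R ^ 2 := by gcongr
    have h4 : ‖(16 * (Real.pi : ℂ) ^ 2 * x)‖ = 16 * Real.pi ^ 2 * x := by
      rw [show (16 * (Real.pi : ℂ) ^ 2 * x) = ((16 * Real.pi ^ 2 * x : ℝ) : ℂ) by push_cast; rfl,
        Complex.norm_real, Real.norm_of_nonneg (by positivity)]
    have h5 := norm_sub_le_norm_add (16 * (Real.pi : ℂ) ^ 2 * x) (z ^ 2)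
    rw [h4, norm_pow, add_comm] at h5
    calc _ ≤ 1 * x := by gcongr; exact min_le_left _ _
      _ ≤ 16 * Real.pi ^ 2 * x - ‖z‖ ^ 2 := by
        have : 2 ≤ 16 * Real.pi ^ 2 := by nlinarith
        nlinarith
      _ ≤ _ := h5
  · have hq : 1 ≤ √x := Real.one_le_sqrt.mpr hx
    have h3 : z ^ 2 + 16 * (Real.pi : ℂ) ^ 2 * x =
        (z + (4 * Real.pi * √x : ℝ) * I) * (z - (4 * Real.pi * √x : ℝ) * I) := by
      have : (x:ℂ) = (√x : ℝ) ^ 2 := by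
        rw [← ofReal_pow, Real.sq_sqrt (by positivity)]
      rw [this]
      push_cast
      ring_nf
      simp only [I_sq]
      ring
    have hb : 1 ≤ 4 * Real.pi * √x := by nlinarith
    generalize 4 * Real.pi * √x = b at h3 hb
    have hre1 : σ ≤ ‖z + b * I‖ := by
      refine h1.le.trans ((le_of_eq ?_).trans (re_le_norm _)); simp
    have hre2 : σ ≤ ‖z - b * I‖ := by
      refine h1.le.trans ((le_of_eq ?_).trans (re_le_norm _)); simp
    have h4 : σ ≤ ‖z + b * I‖ * ‖z - b * I‖ := by
      rcases le_total 0 z.im with h0 | h0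
      · have : 1 ≤ ‖z + b * I‖ := by
          refine (le_trans ?_ (le_abs_self _)).trans (abs_im_le_norm _)
          simp
          linarith
        nlinarith
      · have : 1 ≤ ‖z - b * I‖ := by
          refine (le_trans ?_ (neg_le_abs _)).trans (abs_im_le_norm _)
          simp
          linarith
        nlinarith
    rw [h3, norm_mul]
    calc _ ≤ σ / R ^ 2 * R ^ 2 := by gcongr; exact min_le_right _ _
      _ = σ := by field_simp
      _ ≤ _ := h4

lemma sq_add_sq_mul_mem_slitPlane {z : ℂ} (hz : 0 < z.re) {x : ℝ} (hx : 0 ≤ x) :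
    z ^ 2 + 16 * (Real.pi : ℂ) ^ 2 * x ∈ slitPlane := by
  have h : 16 * (Real.pi : ℂ) ^ 2 * x = ((16 * Real.pi ^ 2 * x : ℝ) : ℂ) := by push_cast; rfl
  have h0 : 0 ≤ 16 * Real.pi ^ 2 * x := by positivity
  rw [h, mem_slitPlane_iff]
  by_cases hy : z.im = 0
  · left
    simp only [sq, add_re, mul_re, ofReal_re, hy]
    nlinarith
  · right
    simp only [sq, add_im, mul_im, ofReal_im]
    intro h2
    have : z.re * z.im = 0 := by linarith
    simp_all

lemma norm_inv_cpow_le {w p : ℂ} {b : ℝ} (hb : 0 < b) (hw : b ≤ ‖w‖) (hp : 0 ≤ p.re) :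
    ‖(w ^ p)⁻¹‖ ≤ Real.exp (Real.pi * |p.im|) * b ^ (-p.re) := by
  have hw0 : 0 < ‖w‖ := hb.trans_le hw
  rw [norm_inv, norm_cpow_of_ne_zero (norm_pos_iff.mp hw0), inv_div, div_eq_mul_inv,
    ← Real.rpow_neg hw0.le]
  have h1 : arg w * p.im ≤ Real.pi * |p.im| :=
    calc arg w * p.im ≤ |arg w * p.im| := le_abs_self _
      _ = |arg w| * |p.im| := abs_mul _ _
      _ ≤ _ := by gcongr; exact abs_arg_le_pi w
  exact mul_le_mul (Real.exp_le_exp.mpr h1) (Real.rpow_le_rpow_of_nonpos hb hw (by linarith))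
    (by positivity) (by positivity)


/-- **An identity for the Ramanujan tau function.**  Let `τ` be the Ramanujan tau function,
i.e. the function satisfying `∑_{n=1}^∞ τ(n) qⁿ = q ∏_{m=1}^∞ (1 - qᵐ)²⁴` for `|q| < 1`.
Then for `Re s > 0` and `Re ν > -13/2`,
`∑_{n=1}^∞ τ(n) n^{(ν+1)/2} K_{ν+1}(s√n)
  = 2^{36+ν} s^{ν+1} π¹² Γ(13+ν) ∑_{n=1}^∞ τ(n)/(s² + 16π²n)^{ν+13}`,
both series converging absolutely. -/
theorem tau_bessel_riesz_identity (τ : ℕ → ℤ)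
    (hτ : ∀ q : ℂ, ‖q‖ < 1 →
      ∑' n : ℕ, (τ (n+1) : ℂ) * q ^ (n+1) = q * ∏' m : ℕ, (1 - q ^ (m+1)) ^ 24)
    (s ν : ℂ) (hs : 0 < s.re) (hν : -13/2 < ν.re) :
    Summable (fun n : ℕ => (τ (n+1) : ℂ) * ((n+1 : ℕ) : ℂ) ^ ((ν+1)/2)
      * besselK (ν+1) (s * Real.sqrt (n+1))) ∧
    Summable (fun n : ℕ =>
      (τ (n+1) : ℂ) / (s^2 + 16 * (Real.pi : ℂ)^2 * (n+1 : ℕ)) ^ (ν + 13)) ∧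
    ∑' n : ℕ, (τ (n+1) : ℂ) * ((n+1 : ℕ) : ℂ) ^ ((ν+1)/2)
        * besselK (ν+1) (s * Real.sqrt (n+1))
      = (2:ℂ) ^ (36 + ν) * s ^ (ν+1) * (Real.pi : ℂ)^12 * Complex.Gamma (13 + ν)
        * ∑' n : ℕ,
            (τ (n+1) : ℂ) / (s^2 + 16 * (Real.pi : ℂ)^2 * (n+1 : ℕ)) ^ (ν + 13) := by
  obtain ⟨σ, hσ, hσ1, hσs⟩ : ∃ σ : ℝ, 0 < σ ∧ σ < 1 ∧ σ < s.re :=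
    ⟨min s.re 1 / 2, by positivity, by linarith [min_le_right s.re 1],
      by linarith [min_le_left s.re 1]⟩
  obtain ⟨R, hR1, hRs⟩ : ∃ R : ℝ, 1 < R ∧ ‖s‖ < R :=
    ⟨‖s‖ + 2, by linarith [norm_nonneg s], by linarith⟩
  let U : Set ℂ := {z | σ < z.re} ∩ Metric.ball 0 R
  have hUo : IsOpen U := (isOpen_lt continuous_const continuous_re).inter Metric.isOpen_ball
  have hUc : IsPreconnected U :=
    ((convex_halfSpace_re_gt σ).inter (convex_ball 0 R)).isPreconnected
  have hsU : s ∈ U := ⟨hσs, by simpa using hRs⟩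
  have h1U : (1:ℂ) ∈ U := ⟨by simpa using hσ1, by simpa using hR1⟩
  have hUpos {z : ℂ} (hz : z ∈ U) : 0 < z.re := hσ.trans hz.1
  let f (n : ℕ) (z : ℂ) : ℂ := (τ (n+1) : ℂ) * ((n+1 : ℕ) : ℂ) ^ ((ν+1)/2)
      * besselK (ν+1) (z * Real.sqrt (n+1))
  let g (n : ℕ) (z : ℂ) : ℂ :=
    (τ (n+1) : ℂ) / (z^2 + 16 * (Real.pi : ℂ)^2 * (n+1 : ℕ)) ^ (ν + 13)
  have hp : 13 / 2 < (ν + 13).re := by simp; linarith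
  obtain ⟨C, hC0, hC⟩ := exists_norm_besselK_le (ν + 1) hσ
  have hfle (n : ℕ) (z : ℂ) (hz : z ∈ U) : ‖f n z‖ ≤
      C * (|(τ (n+1) : ℝ)| * ((n:ℝ) + 1) ^ ((ν + 1) / 2).re * Real.exp (-σ * √((n:ℝ) + 1))) := by
    have h1 : σ * √((n:ℝ) + 1) ≤ (z * √((n:ℝ) + 1)).re := by
      rw [re_mul_ofReal]
      exact mul_le_mul_of_nonneg_right hz.1.le (Real.sqrt_nonneg _)
    have h2 := hC (z * √((n:ℝ) + 1))
      ((le_mul_of_one_le_right hσ.le (Real.one_le_sqrt.mpr (by simp))).trans h1)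
    simp only [f]
    rw [norm_mul, norm_mul, Complex.norm_intCast,
      norm_natCast_cpow_of_pos n.succ_pos, Nat.cast_add_one]
    calc _ ≤ |(τ (n+1) : ℝ)| * ((n:ℝ) + 1) ^ ((ν + 1) / 2).re *
            (C * Real.exp (-σ * √((n:ℝ) + 1))) := by
          gcongr
          refine h2.trans ?_
          gcongr
          linarith
      _ = _ := by ring
  have hfs := (summable_abs_tau_mul_exp_neg_sqrt hτ hσ ((ν + 1) / 2).re).mul_left C
  have hδ : 0 < min 1 (σ / R ^ 2) := by positivity
  set δ := min 1 (σ / R ^ 2)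
  have hcast (n : ℕ) : ((n+1 : ℕ) : ℂ) = (((n:ℝ) + 1 : ℝ) : ℂ) := by push_cast; rfl
  have hgle (n : ℕ) (z : ℂ) (hz : z ∈ U) : ‖g n z‖ ≤
      Real.exp (Real.pi * |(ν + 13).im|) * δ ^ (-(ν + 13).re) *
        (|(τ (n+1) : ℝ)| * ((n:ℝ) + 1) ^ (-(ν + 13).re)) := by
    have h1 := norm_sq_add_sq_mul_ge hσ hz.1 (by simpa using hz.2)
      (x := (n:ℝ) + 1) (by simp)
    have h2 := norm_inv_cpow_le (p := ν + 13) (by positivity) h1 (by linarith)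
    simp only [g]
    rw [div_eq_mul_inv, norm_mul, Complex.norm_intCast, hcast]
    rw [Real.mul_rpow hδ.le (by positivity)] at h2
    calc _ ≤ |(τ (n+1) : ℝ)| * _ := mul_le_mul_of_nonneg_left h2 (abs_nonneg _)
      _ = _ := by ring
  have hgs := (summable_abs_tau_mul_rpow hτ hp).mul_left
    (Real.exp (Real.pi * |(ν + 13).im|) * δ ^ (-(ν + 13).re))
  refine ⟨.of_norm_bounded hfs fun n => hfle n s hsU,
    .of_norm_bounded hgs fun n => hgle n s hsU, ?_⟩
  have hfd (n : ℕ) : DifferentiableOn ℂ (f n) U := by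
    intro z hz
    have h1 : 0 < (z * √((n:ℝ) + 1)).re := by
      rw [re_mul_ofReal]
      have := hUpos hz
      positivity
    have h2 : DifferentiableAt ℂ (fun z => besselK (ν + 1) (z * √((n:ℝ) + 1))) z :=
      DifferentiableAt.comp (g := besselK (ν + 1)) z (differentiableAt_besselK (ν + 1) h1)
        (differentiableAt_id.mul_const _)
    exact (h2.const_mul _).differentiableWithinAt
  have hgd (n : ℕ) : DifferentiableOn ℂ (g n) U := by
    intro z hz
    have h1 := sq_add_sq_mul_mem_slitPlane (hUpos hz) (x := (n:ℝ) + 1) (by positivity)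
    rw [← hcast] at h1
    have h2 : z ^ 2 + 16 * (Real.pi : ℂ) ^ 2 * (n+1 : ℕ) ≠ 0 := slitPlane_ne_zero h1
    have h3 : DifferentiableAt ℂ
        (fun z : ℂ => (z ^ 2 + 16 * (Real.pi : ℂ) ^ 2 * (n+1 : ℕ)) ^ (ν + 13)) z :=
      DifferentiableAt.cpow (by fun_prop) (by fun_prop) h1
    exact ((differentiableAt_const _).div h3
      (fun h => h2 ((cpow_eq_zero_iff _ _).mp h).1)).differentiableWithinAt
  have hF : DifferentiableOn ℂ (fun z => ∑' n, f n z) U :=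
    differentiableOn_tsum_of_summable_norm hfs hfd hUo hfle
  have hG : DifferentiableOn ℂ (fun z => (2:ℂ) ^ (36 + ν) * z ^ (ν+1) * (Real.pi : ℂ)^12 *
      Complex.Gamma (13 + ν) * ∑' n, g n z) U := by
    refine DifferentiableOn.mul ?_ (differentiableOn_tsum_of_summable_norm hgs hgd hUo hgle)
    intro z hz
    have : DifferentiableAt ℂ (fun z : ℂ => z ^ (ν + 1)) z :=
      DifferentiableAt.cpow (by fun_prop) (by fun_prop) (Or.inl (hUpos hz))
    exact (((this.const_mul _).mul_const _).mul_const _).differentiableWithinAt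
  have hmap : Tendsto ((↑) : ℝ → ℂ) (nhdsWithin 1 {1}ᶜ) (nhdsWithin 1 {1}ᶜ) := by
    refine tendsto_nhdsWithin_iff.mpr
      ⟨(by simpa using continuous_ofReal.tendsto 1 : Tendsto _ (nhds (1:ℝ)) (nhds (1:ℂ))).mono_left
        nhdsWithin_le_nhds, ?_⟩
    filter_upwards [self_mem_nhdsWithin] with x hx
    simpa using hx
  have hpos : ∀ᶠ x : ℝ in nhdsWithin 1 {1}ᶜ, 0 < x :=
    nhdsWithin_le_nhds (lt_mem_nhds one_pos)
  exact (hF.analyticOnNhd hUo).eqOn_of_preconnected_of_frequently_eq (hG.analyticOnNhd hUo) hUc h1U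
    (hmap.frequently (hpos.mono fun x hx =>
      tsum_tau_mul_besselK_eq_of_pos hτ hν hx).frequently) hsU
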